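/- Let m > 0 be the particle mass and β > 0 the inverse temperature. Suppose the differential cross-section σ satisfies: there exist α with 0 < α < 3, c > -2 and B' > 0 such that σ(g, Θ) ≤ B' · g^(−α) · (sin Θ)^c for all g > 0 and Θ ∈ (0, π). Then the interaction is soft: there exists a constant ν₀ > 0 such that the collision frequency satisfies ν(p) ≤ ν₀ · (E(p)/m)^(−α/2) for all p ∈ ℝ³; in particular ν is bounded above by ν₀. -/

import Mathlib

open MeasureTheory Real RealInnerProductSpace

/-- Relativistic energy `E(p) = √(‖p‖² + m²)`. -/
noncomputable def energy (m : ℝ) (p : EuclideanSpace ℝ (Fin 3)) : ℝ :=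
  Real.sqrt (‖p‖ ^ 2 + m ^ 2)

/-- Relative momentum `g(p,q) = √(2(E(p)E(q) − ⟨p,q⟩ − m²))`. -/
noncomputable def relMom (m : ℝ) (p q : EuclideanSpace ℝ (Fin 3)) : ℝ :=
  Real.sqrt (2 * (energy m p * energy m q - ⟪p, q⟫ - m ^ 2))

/-- Total cross-section `σ_T(g) = 2π ∫_0^π σ(g,Θ) sin Θ dΘ`. -/
noncomputable def totalXsec (σ : ℝ → ℝ → ℝ) (g : ℝ) : ℝ :=
  2 * Real.pi * ∫ Θ in (0:ℝ)..Real.pi, σ g Θ * Real.sin Θ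

/-- Collision frequency
`ν(p) = E(p)⁻¹ ∫ (e^{−βE(q)}/E(q)) g(p,q) √(g(p,q)² + 4m²) σ_T(g(p,q)) dq`. -/
noncomputable def collFreq (m β : ℝ) (σ : ℝ → ℝ → ℝ) (p : EuclideanSpace ℝ (Fin 3)) : ℝ :=
  (energy m p)⁻¹ * ∫ q : EuclideanSpace ℝ (Fin 3),
    (Real.exp (-β * energy m q) / energy m q) * relMom m p q *
      Real.sqrt ((relMom m p q) ^ 2 + 4 * m ^ 2) * totalXsec σ (relMom m p q)

lemma aux_energy_pos (m : ℝ) (hm : 0 < m) (p : EuclideanSpace ℝ (Fin 3)) : 0 < energy m p := by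
  unfold energy; positivity

lemma aux_energy_sq (m : ℝ) (p : EuclideanSpace ℝ (Fin 3)) :
    energy m p ^ 2 = ‖p‖ ^ 2 + m ^ 2 := by
  unfold energy; exact Real.sq_sqrt (by positivity)

lemma aux_le_energy (m : ℝ) (hm : 0 < m) (p : EuclideanSpace ℝ (Fin 3)) : m ≤ energy m p := by
  have := aux_energy_sq m p
  have h2 := aux_energy_pos m hm p
  nlinarith [sq_nonneg ‖p‖]

lemma aux_norm_le_energy (m : ℝ) (hm : 0 < m) (p : EuclideanSpace ℝ (Fin 3)) :
    ‖p‖ ≤ energy m p := by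
  have := aux_energy_sq m p
  have h2 := aux_energy_pos m hm p
  nlinarith [norm_nonneg p]

/-- total cross-section bound -/
lemma aux_totalXsec (σ : ℝ → ℝ → ℝ) (hσ : ∀ g Θ, 0 ≤ σ g Θ)
    (α c B' : ℝ) (hc : -2 < c) (hB' : 0 < B')
    (hup : ∀ g Θ : ℝ, 0 < g → Θ ∈ Set.Ioo 0 Real.pi →
      σ g Θ ≤ B' * g ^ (-α) * Real.sin Θ ^ c) :
    ∃ C : ℝ, 0 ≤ C ∧ ∀ g, 0 < g → totalXsec σ g ≤ C * g ^ (-α) := by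
  set d := min (c + 1) 0 with hd
  have hd1 : -1 < d := by rw [hd]; exact lt_min (by linarith) (by norm_num)
  have hd0 : d ≤ 0 := min_le_right _ _
  have hdc : d ≤ c + 1 := min_le_left _ _
  set D : ℝ → ℝ := fun Θ => (2 / π) ^ d * (Θ ^ d + (π - Θ) ^ d) with hD
  have hDi : IntervalIntegrable D volume 0 π := by
    have h1 : IntervalIntegrable (fun x : ℝ => x ^ d) volume 0 π :=
      intervalIntegral.intervalIntegrable_rpow' hd1
    have h2 : IntervalIntegrable (fun x : ℝ => (π - x) ^ d) volume 0 π := by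
      have := (h1.comp_sub_left π).symm
      simpa using this
    exact (h1.add h2).const_mul _
  have hDpos : ∀ Θ ∈ Set.Ioo 0 π, 0 ≤ D Θ := by
    intro Θ hΘ
    have := hΘ.1
    have h3 : 0 < π - Θ := by linarith [hΘ.2]
    simp only [hD]
    have := Real.pi_pos
    positivity
  have hsin : ∀ Θ ∈ Set.Ioo 0 π, sin Θ ^ c * sin Θ ≤ D Θ := by
    intro Θ hΘ
    have hs := Real.sin_pos_of_mem_Ioo hΘ
    have h0 := hΘ.1
    have h3 : 0 < π - Θ := by linarith [hΘ.2]
    have hpi := Real.pi_pos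
    have e1 : sin Θ ^ c * sin Θ = sin Θ ^ (c + 1) := by
      rw [Real.rpow_add hs, Real.rpow_one]
    have e2 : sin Θ ^ (c + 1) ≤ sin Θ ^ d :=
      Real.rpow_le_rpow_of_exponent_ge hs (Real.sin_le_one _) hdc
    rw [e1]
    refine e2.trans ?_
    simp only [hD]
    rcases le_total Θ (π / 2) with h | h
    · have h4 := Real.mul_le_sin h0.le h
      have h5 : sin Θ ^ d ≤ (2 / π * Θ) ^ d :=
        Real.rpow_le_rpow_of_nonpos (by positivity) h4 hd0
      rw [Real.mul_rpow (by positivity) h0.le] at h5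
      have h6 : 0 ≤ (2 / π) ^ d * (π - Θ) ^ d := by positivity
      linarith
    · have h4 := Real.mul_le_sin h3.le (by linarith)
      rw [Real.sin_pi_sub] at h4
      have h5 : sin Θ ^ d ≤ (2 / π * (π - Θ)) ^ d :=
        Real.rpow_le_rpow_of_nonpos (by positivity) h4 hd0
      rw [Real.mul_rpow (by positivity) h3.le] at h5
      have h6 : 0 ≤ (2 / π) ^ d * Θ ^ d := by positivity
      linarith
  have hae : ∀ᵐ Θ ∂(volume.restrict (Set.Ioc 0 π)), Θ ∈ Set.Ioo 0 π := by
    rw [← MeasureTheory.restrict_Ioo_eq_restrict_Ioc]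
    exact ae_restrict_mem measurableSet_Ioo
  refine ⟨2 * π * (B' * ∫ Θ in (0:ℝ)..π, D Θ), ?_, ?_⟩
  · have : 0 ≤ ∫ Θ in (0:ℝ)..π, D Θ := by
      rw [intervalIntegral.integral_of_le Real.pi_pos.le]
      apply integral_nonneg_of_ae
      filter_upwards [hae] with Θ hΘ using hDpos Θ hΘ
    have := Real.pi_pos
    positivity
  · intro g hg
    unfold totalXsec
    have key : ∫ Θ in (0:ℝ)..π, σ g Θ * sin Θ ≤ ∫ Θ in (0:ℝ)..π, (B' * g ^ (-α)) * D Θ := by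
      rw [intervalIntegral.integral_of_le Real.pi_pos.le,
        intervalIntegral.integral_of_le Real.pi_pos.le]
      apply integral_mono_of_nonneg
      · filter_upwards [hae] with Θ hΘ
        exact mul_nonneg (hσ _ _) (Real.sin_pos_of_mem_Ioo hΘ).le
      · exact (hDi.const_mul _).1
      · filter_upwards [hae] with Θ hΘ
        have hs := Real.sin_pos_of_mem_Ioo hΘ
        calc σ g Θ * sin Θ ≤ (B' * g ^ (-α) * sin Θ ^ c) * sin Θ :=
              mul_le_mul_of_nonneg_right (hup g Θ hg hΘ) hs.le
          _ = (B' * g ^ (-α)) * (sin Θ ^ c * sin Θ) := by ring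
          _ ≤ _ := mul_le_mul_of_nonneg_left (hsin Θ hΘ) (by positivity)
    rw [intervalIntegral.integral_const_mul] at key
    calc _ ≤ 2 * π * (B' * g ^ (-α) * ∫ Θ in (0:ℝ)..π, D Θ) :=
          mul_le_mul_of_nonneg_left key (by positivity)
      _ = _ := by ring

lemma aux_totalXsec_nonneg (σ : ℝ → ℝ → ℝ) (hσ : ∀ g Θ, 0 ≤ σ g Θ) (g : ℝ) :
    0 ≤ totalXsec σ g := by
  unfold totalXsec
  refine mul_nonneg (by positivity) ?_
  apply intervalIntegral.integral_nonneg Real.pi_pos.le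
  intro Θ hΘ
  exact mul_nonneg (hσ _ _) (Real.sin_nonneg_of_mem_Icc hΘ)

lemma aux_integrable_one (t b : ℝ) (ht : -1 < t) (hb : 0 < b) :
    Integrable (fun x : ℝ => exp (-b * |x|) * |x| ^ t) := by
  have h := integrableOn_rpow_mul_exp_neg_mul_rpow (p := 1) ht one_pos hb
  have h1 : IntegrableOn (fun x : ℝ => exp (-b * |x|) * |x| ^ t) (Set.Ioi 0) := by
    refine h.congr_fun (fun x hx => ?_) measurableSet_Ioi
    have hx' : (0:ℝ) < x := hx
    simp only [abs_of_pos hx', Real.rpow_one]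
    ring
  rw [← integrableOn_univ, ← @Set.Iio_union_Ici _ _ (0 : ℝ), integrableOn_union,
    integrableOn_Ici_iff_integrableOn_Ioi]
  refine ⟨?_, h1⟩
  have h2 := h1.comp_neg
  simpa using h2

/-- dominating function -/
noncomputable def auxDom (s b : ℝ) (u : EuclideanSpace ℝ (Fin 3)) : ℝ :=
  ∏ i : Fin 3, (exp (-b * |u i|) * |u i| ^ ((![0, -s, -s] : Fin 3 → ℝ) i))

lemma aux_dom_integrable (s b : ℝ) (hs : s < 1) (hb : 0 < b) : Integrable (auxDom s b) := by
  have h : Integrable (fun x : Fin 3 → ℝ =>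
      ∏ i : Fin 3, (exp (-b * |x i|) * |x i| ^ ((![0, -s, -s] : Fin 3 → ℝ) i))) := by
    refine Integrable.fintype_prod (f := fun i x =>
      exp (-b * |x|) * |x| ^ ((![0, -s, -s] : Fin 3 → ℝ) i)) (μ := fun _ => volume) ?_
    intro i
    apply aux_integrable_one _ _ _ hb
    fin_cases i <;> simp <;> linarith
  exact (PiLp.volume_preserving_ofLp (Fin 3)).integrable_comp_of_integrable h

lemma aux_ae_coord (i : Fin 3) : ∀ᵐ u : EuclideanSpace ℝ (Fin 3), u i ≠ 0 := by
  have h : ∀ᵐ x : Fin 3 → ℝ, x i ≠ 0 := by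
    have h1 : ∀ᵐ y : ℝ, y ≠ 0 := by simp [ae_iff]
    exact (MeasureTheory.Measure.quasiMeasurePreserving_eval (fun _ : Fin 3 => (volume : Measure ℝ)) i).ae h1
  exact (PiLp.volume_preserving_ofLp (Fin 3)).quasiMeasurePreserving.ae h

lemma aux_rotation (p : EuclideanSpace ℝ (Fin 3)) :
    ∃ R : EuclideanSpace ℝ (Fin 3) ≃ₗᵢ[ℝ] EuclideanSpace ℝ (Fin 3),
      ∀ q, ⟪p, q⟫ = ‖p‖ * (R q) 0 := by
  have h : ‖p‖ = ‖EuclideanSpace.single (0 : Fin 3) ‖p‖‖ := by simp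
  refine ⟨(ℝ ∙ (p - EuclideanSpace.single (0 : Fin 3) ‖p‖))ᗮ.reflection, fun q => ?_⟩
  have h2 := Submodule.reflection_sub h
  rw [← LinearIsometryEquiv.inner_map_map
    ((ℝ ∙ (p - EuclideanSpace.single (0 : Fin 3) ‖p‖))ᗮ.reflection) p q, h2]
  simp [EuclideanSpace.inner_single_left]

/-- elementary lower bound -/
lemma aux_lower (m P E F a b c : ℝ) (hm : 0 < m) (hP : 0 ≤ P) (hE : 0 < E) (hF : 0 < F)
    (hE2 : E ^ 2 = P ^ 2 + m ^ 2) (hF2 : F ^ 2 = a ^ 2 + b ^ 2 + c ^ 2 + m ^ 2) :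
    E * (|b| * |c|) ≤ 2 * (E * F - P * a - m ^ 2) * F := by
  have hw : 2 * (|b| * |c|) ≤ b ^ 2 + c ^ 2 := by
    nlinarith [sq_nonneg (|b| - |c|), sq_abs b, sq_abs c]
  have h1 : P * (b ^ 2 + c ^ 2) ≤ 2 * (E * F - P * a - m ^ 2) * F := by
    set r := √(a ^ 2 + b ^ 2 + c ^ 2) with hr
    have hr0 : 0 ≤ r := Real.sqrt_nonneg _
    have hr2 : r ^ 2 = a ^ 2 + b ^ 2 + c ^ 2 := Real.sq_sqrt (by positivity)
    have hrF : r ≤ F := abs_le_of_sq_le_sq' (by nlinarith) hF.le |>.2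
    have har : |a| ≤ r := by
      rw [hr]; apply Real.abs_le_sqrt; nlinarith [sq_nonneg b, sq_nonneg c]
    have har' := abs_le.1 har
    have hcs : P * r + m ^ 2 ≤ E * F := by
      apply abs_le_of_sq_le_sq' _ (by positivity) |>.2
      rw [mul_pow, hE2, hF2, ← hr2]
      nlinarith [sq_nonneg (P * m - m * r)]
    have e1 : P * (r - a) ≤ E * F - P * a - m ^ 2 := by linarith
    have e2 : P * (r - a) * (2 * F) ≤ (E * F - P * a - m ^ 2) * (2 * F) :=
      mul_le_mul_of_nonneg_right e1 (by positivity)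
    have e3 : P * (r - a) * (r + a) ≤ P * (r - a) * (2 * F) :=
      mul_le_mul_of_nonneg_left (by linarith) (mul_nonneg hP (by linarith))
    have e4 : P * (r - a) * (r + a) = P * (b ^ 2 + c ^ 2) := by
      linear_combination P * hr2
    linarith
  have h2 : m * (b ^ 2 + c ^ 2) ≤ 2 * (E * F - P * a - m ^ 2) * F := by
    set M := √(b ^ 2 + c ^ 2 + m ^ 2) with hM
    have hM0 : 0 ≤ M := Real.sqrt_nonneg _
    have hM2 : M ^ 2 = b ^ 2 + c ^ 2 + m ^ 2 := Real.sq_sqrt (by positivity)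
    have hmM : m ≤ M := abs_le_of_sq_le_sq' (by nlinarith [sq_nonneg b, sq_nonneg c]) hM0 |>.2
    have hMF : M ≤ F := abs_le_of_sq_le_sq' (by nlinarith [sq_nonneg a]) hF.le |>.2
    have hcs : P * a + m * M ≤ E * F := by
      apply abs_le_of_sq_le_sq' _ (by positivity) |>.2
      have : F ^ 2 = a ^ 2 + M ^ 2 := by rw [hM2]; linarith
      rw [mul_pow, hE2, this]
      nlinarith [sq_nonneg (P * M - m * a)]
    have e1 : m * (M - m) ≤ E * F - P * a - m ^ 2 := by linarith
    have e2 : m * (M - m) * (2 * F) ≤ (E * F - P * a - m ^ 2) * (2 * F) :=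
      mul_le_mul_of_nonneg_right e1 (by positivity)
    have e3 : m * (M - m) * (M + m) ≤ m * (M - m) * (2 * F) :=
      mul_le_mul_of_nonneg_left (by linarith) (mul_nonneg hm.le (by linarith))
    have e4 : m * (M - m) * (M + m) = m * (b ^ 2 + c ^ 2) := by
      linear_combination m * hM2
    linarith
  have h3 : E ≤ P + m := abs_le_of_sq_le_sq' (by nlinarith) (by positivity) |>.2
  have h4 : E * (2 * (|b| * |c|)) ≤ (P + m) * (b ^ 2 + c ^ 2) :=
    mul_le_mul h3 hw (by positivity) (by positivity)
  linarith

/-- bound on powers of g -/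
lemma aux_pow (α E F x g : ℝ) (hE : 0 < E) (hF : 0 < F) (hx : 0 < x)
    (hg : 0 < g) (hlow : E * x ≤ g ^ 2 * F) (hupp : g ^ 2 ≤ 4 * (E * F)) :
    g ^ (1 - α) ≤ 4 ^ (|1 - α| / 2) * E ^ ((1 - α) / 2) * F ^ (|1 - α| / 2) *
      x ^ (-(max (α - 1) 0 / 2)) := by
  have e0 : g ^ (1 - α) = (g ^ 2) ^ ((1 - α) / 2) := by
    rw [← Real.rpow_natCast, ← Real.rpow_mul hg.le]; congr 1; push_cast; ring
  rw [e0]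
  rcases le_total α 1 with h | h
  · rw [abs_of_nonneg (by linarith : 0 ≤ 1 - α), max_eq_right (by linarith)]
    simp only [zero_div, neg_zero, Real.rpow_zero, mul_one]
    rw [mul_assoc, ← Real.mul_rpow hE.le hF.le, ← Real.mul_rpow (by norm_num) (by positivity)]
    exact Real.rpow_le_rpow (by positivity) hupp (by linarith)
  · rw [abs_of_nonpos (by linarith : 1 - α ≤ 0), max_eq_left (by linarith)]
    have h1 : E * x / F ≤ g ^ 2 := by rw [div_le_iff₀ hF]; exact hlow
    have h2 : (g ^ 2) ^ ((1 - α) / 2) ≤ (E * x / F) ^ ((1 - α) / 2) :=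
      Real.rpow_le_rpow_of_nonpos (by positivity) h1 (by linarith)
    have h3 : (E * x / F) ^ ((1 - α) / 2) =
        E ^ ((1 - α) / 2) * F ^ (-(1 - α) / 2) * x ^ (-((α - 1) / 2)) := by
      rw [Real.div_rpow (by positivity) hF.le, Real.mul_rpow hE.le hx.le, neg_div,
        Real.rpow_neg hF.le, show -((α - 1) / 2) = (1 - α) / 2 by ring]
      field_simp
    rw [h3] at h2
    have h4 : (1:ℝ) ≤ 4 ^ (-(1 - α) / 2) := Real.one_le_rpow (by norm_num) (by linarith)
    refine h2.trans ?_
    have h5 : 0 ≤ E ^ ((1 - α) / 2) * F ^ (-(1 - α) / 2) * x ^ (-((α - 1) / 2)) := by positivity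
    nlinarith

lemma aux_exp (m β k F : ℝ) (hm : 0 < m) (hβ : 0 < β) (hk : k ≤ 1) (hF : m ≤ F) :
    exp (-β * F) * F ^ k ≤ m ^ (k - 1) * (2 / β) * exp (-(β / 2) * F) := by
  have hF0 : 0 < F := hm.trans_le hF
  have h1 : F ^ k = F ^ (k - 1) * F := by
    rw [Real.rpow_sub_one hF0.ne']; field_simp
  have h2 : F ^ (k - 1) ≤ m ^ (k - 1) := Real.rpow_le_rpow_of_nonpos hm hF (by linarith)
  have h3 : F ≤ 2 / β * exp (β / 2 * F) := by
    have := Real.add_one_le_exp (β / 2 * F)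
    calc F = 2 / β * (β / 2 * F) := by field_simp
      _ ≤ _ := mul_le_mul_of_nonneg_left (by linarith) (by positivity)
  have h4 : exp (-(β / 2) * F) = exp (-β * F) * exp (β / 2 * F) := by
    rw [← Real.exp_add]; congr 1; ring
  rw [h1, h4]
  calc exp (-β * F) * (F ^ (k - 1) * F)
      ≤ exp (-β * F) * (m ^ (k - 1) * (2 / β * exp (β / 2 * F))) := by gcongr
    _ = _ := by ring

lemma aux_dom_eq (s b : ℝ) (u : EuclideanSpace ℝ (Fin 3)) :
    auxDom s b u = exp (-b * (|u 0| + |u 1| + |u 2|)) * (|u 1| * |u 2|) ^ (-s) := by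
  unfold auxDom
  rw [Real.mul_rpow (abs_nonneg _) (abs_nonneg _),
    show -b * (|u 0| + |u 1| + |u 2|) = -b * |u 0| + -b * |u 1| + -b * |u 2| by ring,
    Real.exp_add, Real.exp_add]
  simp [Fin.prod_univ_three]
  ring

set_option maxHeartbeats 1000000 in
lemma aux_integrand (m β : ℝ) (hm : 0 < m) (hβ : 0 < β)
    (σ : ℝ → ℝ → ℝ) (α C : ℝ) (hα0 : 0 < α) (hα3 : α < 3) (hC : 0 ≤ C)
    (hT : ∀ g, 0 < g → totalXsec σ g ≤ C * g ^ (-α)) :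
    ∃ K : ℝ, 0 < K ∧ ∀ (p q u : EuclideanSpace ℝ (Fin 3)), ‖u‖ = ‖q‖ →
      ⟪p, q⟫ = ‖p‖ * u 0 → u 1 ≠ 0 → u 2 ≠ 0 →
      (Real.exp (-β * energy m q) / energy m q) * relMom m p q *
        Real.sqrt ((relMom m p q) ^ 2 + 4 * m ^ 2) * totalXsec σ (relMom m p q) ≤
      K * energy m p ^ (1 - α / 2) * auxDom (max (α - 1) 0 / 2) (β / 6) u := by
  set k := |1 - α| / 2 - 1 / 2 with hk
  have hk1 : k ≤ 1 := by
    have : |1 - α| ≤ 2 := by rw [abs_le]; constructor <;> linarith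
    linarith
  refine ⟨(C + 1) * √6 * 4 ^ (|1 - α| / 2) * (m ^ (k - 1) * (2 / β)), by positivity, ?_⟩
  intro p q u hun hpq hu1 hu2
  have hE := aux_energy_pos m hm p
  have hF := aux_energy_pos m hm q
  have hEm := aux_le_energy m hm p
  have hFm := aux_le_energy m hm q
  have hE2 := aux_energy_sq m p
  have hF2 := aux_energy_sq m q
  have hEn := aux_norm_le_energy m hm p
  have hFn := aux_norm_le_energy m hm q
  have huu : ‖q‖ ^ 2 = u 0 ^ 2 + u 1 ^ 2 + u 2 ^ 2 := by
    rw [← hun, EuclideanSpace.norm_sq_eq, Fin.sum_univ_three]; simp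
  have hx : 0 < |u 1| * |u 2| := by positivity
  have hin : |⟪p, q⟫| ≤ energy m p * energy m q :=
    (abs_real_inner_le_norm p q).trans (mul_le_mul hEn hFn (norm_nonneg _) hE.le)
  have hlow := aux_lower m ‖p‖ (energy m p) (energy m q) (u 0) (u 1) (u 2) hm (norm_nonneg _)
    hE hF hE2 (by rw [hF2, huu])
  rw [← hpq] at hlow
  have hgpos : 0 < 2 * (energy m p * energy m q - ⟪p, q⟫ - m ^ 2) := by
    have : 0 < 2 * (energy m p * energy m q - ⟪p, q⟫ - m ^ 2) * energy m q :=
      lt_of_lt_of_le (by positivity) hlow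
    exact pos_of_mul_pos_left this hF.le
  have hg : 0 < relMom m p q := Real.sqrt_pos.2 hgpos
  have hg2 : relMom m p q ^ 2 = 2 * (energy m p * energy m q - ⟪p, q⟫ - m ^ 2) :=
    Real.sq_sqrt hgpos.le
  have hdom := aux_dom_eq (max (α - 1) 0 / 2) (β / 6) u
  have hcoord : |u 0| + |u 1| + |u 2| ≤ 3 * energy m q := by
    have hi : ∀ i, |u i| ≤ energy m q := fun i =>
      (PiLp.norm_apply_le u i).trans (hun.le.trans hFn)
    linarith [hi 0, hi 1, hi 2]
  have hin' := abs_le.1 hin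
  have hmm : m ^ 2 ≤ energy m p * energy m q := by nlinarith
  generalize hgg : relMom m p q = g at *
  generalize energy m p = E at *
  generalize energy m q = F at *
  rw [← hg2] at hlow
  have hpow := aux_pow α E F _ g hE hF hx hg hlow (by nlinarith)
  generalize |u 1| * |u 2| = x at *
  generalize max (α - 1) 0 / 2 = s at *
  have hsq : √(g ^ 2 + 4 * m ^ 2) ≤ √6 * (E ^ (1/2:ℝ) * F ^ (1/2:ℝ)) := by
    rw [← Real.mul_rpow hE.le hF.le, ← Real.sqrt_eq_rpow, ← Real.sqrt_mul (by norm_num)]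
    apply Real.sqrt_le_sqrt
    linarith
  have hT' : totalXsec σ g ≤ (C + 1) * g ^ (-α) := (hT g hg).trans (by gcongr; linarith)
  have hgg2 : g * g ^ (-α) = g ^ (1 - α) := by
    rw [sub_eq_add_neg, Real.rpow_add hg, Real.rpow_one]
  have hexp := aux_exp m β k F hm hβ hk1 hFm
  have hexp2 : exp (-(β / 2) * F) ≤ exp (-(β / 6) * (|u 0| + |u 1| + |u 2|)) := by
    apply Real.exp_le_exp.2
    have h9 := mul_le_mul_of_nonneg_left hcoord (by positivity : 0 ≤ β / 6)
    linarith only [h9]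
  rw [hdom]
  have hFk : F ^ (|1 - α| / 2) * F ^ (1/2:ℝ) = F * F ^ k := by
    rw [← Real.rpow_add hF, ← Real.rpow_one_add' hF.le]
    · congr 1; rw [hk]; ring
    · rw [hk]; have := abs_nonneg (1 - α); linarith
  have hEk : E ^ ((1 - α) / 2) * E ^ (1/2:ℝ) = E ^ (1 - α / 2) := by
    rw [← Real.rpow_add hE]; congr 1; ring
  calc exp (-β * F) / F * g * √(g ^ 2 + 4 * m ^ 2) * totalXsec σ g
      ≤ exp (-β * F) / F * g * (√6 * (E ^ (1/2:ℝ) * F ^ (1/2:ℝ))) * ((C + 1) * g ^ (-α)) := by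
        refine (mul_le_mul_of_nonneg_left hT' (by positivity)).trans ?_
        gcongr
    _ = exp (-β * F) / F * (√6 * (E ^ (1/2:ℝ) * F ^ (1/2:ℝ))) * (C + 1) * g ^ (1 - α) := by
        rw [← hgg2]; ring
    _ ≤ exp (-β * F) / F * (√6 * (E ^ (1/2:ℝ) * F ^ (1/2:ℝ))) * (C + 1) *
          (4 ^ (|1 - α| / 2) * E ^ ((1 - α) / 2) * F ^ (|1 - α| / 2) * x ^ (-s)) := by
        gcongr
    _ = (C + 1) * √6 * 4 ^ (|1 - α| / 2) * (exp (-β * F) / F) *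
          (E ^ ((1 - α) / 2) * E ^ (1/2:ℝ)) * (F ^ (|1 - α| / 2) * F ^ (1/2:ℝ)) * x ^ (-s) := by
        ring
    _ = (C + 1) * √6 * 4 ^ (|1 - α| / 2) * E ^ (1 - α / 2) * x ^ (-s) *
          (exp (-β * F) * F ^ k) := by
        rw [hFk, hEk]; field_simp
    _ ≤ (C + 1) * √6 * 4 ^ (|1 - α| / 2) * E ^ (1 - α / 2) * x ^ (-s) *
          (m ^ (k - 1) * (2 / β) * exp (-(β / 6) * (|u 0| + |u 1| + |u 2|))) := by
        refine mul_le_mul_of_nonneg_left (hexp.trans ?_) (by positivity)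
        gcongr
    _ = _ := by ring

/-- an upper bound `σ(g,Θ) ≤ B' g^{−α} (sin Θ)^c` with `0 < α < 3` forces the
interaction to be soft: `ν(p) ≤ ν₀ (E(p)/m)^{−α/2}`, in particular `ν ≤ ν₀`. -/
theorem soft_interaction_upper_bound (m β : ℝ) (hm : 0 < m) (hβ : 0 < β)
    (σ : ℝ → ℝ → ℝ) (hσ : ∀ g Θ, 0 ≤ σ g Θ)
    (α c B' : ℝ) (hα0 : 0 < α) (hα3 : α < 3) (hc : -2 < c) (hB' : 0 < B')
    (hup : ∀ g Θ : ℝ, 0 < g → Θ ∈ Set.Ioo 0 Real.pi →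
      σ g Θ ≤ B' * g ^ (-α) * Real.sin Θ ^ c) :
    ∃ ν₀ : ℝ, 0 < ν₀ ∧
      (∀ p : EuclideanSpace ℝ (Fin 3),
        collFreq m β σ p ≤ ν₀ * (energy m p / m) ^ (-(α / 2))) ∧
      (∀ p : EuclideanSpace ℝ (Fin 3), collFreq m β σ p ≤ ν₀) := by
  obtain ⟨C, hC, hT⟩ := aux_totalXsec σ hσ α c B' hc hB' hup
  obtain ⟨K, hK, hbnd⟩ := aux_integrand m β hm hβ σ α C hα0 hα3 hC hT
  set s := max (α - 1) 0 / 2 with hs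
  have hs1 : s < 1 := by
    have : max (α - 1) 0 < 2 := max_lt (by linarith) (by norm_num)
    linarith
  have hDi := aux_dom_integrable s (β / 6) hs1 (by positivity)
  set I := ∫ u, auxDom s (β / 6) u with hI
  have hI0 : 0 ≤ I := by
    apply integral_nonneg
    intro u
    show 0 ≤ auxDom s (β / 6) u
    rw [aux_dom_eq]; positivity
  have main : ∀ p : EuclideanSpace ℝ (Fin 3),
      collFreq m β σ p ≤ (K * (I + 1) * m ^ (-(α / 2))) * (energy m p / m) ^ (-(α / 2)) := by
    intro p
    have hE := aux_energy_pos m hm p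
    obtain ⟨R, hR⟩ := aux_rotation p
    have hRm : MeasurePreserving R volume volume := R.measurePreserving
    have hb : ∫ q : EuclideanSpace ℝ (Fin 3),
        (Real.exp (-β * energy m q) / energy m q) * relMom m p q *
          Real.sqrt ((relMom m p q) ^ 2 + 4 * m ^ 2) * totalXsec σ (relMom m p q) ≤
        ∫ q, K * energy m p ^ (1 - α / 2) * auxDom s (β / 6) (R q) := by
      apply integral_mono_of_nonneg
      · refine Filter.Eventually.of_forall fun q => ?_
        have hF := aux_energy_pos m hm q
        have h1 := aux_totalXsec_nonneg σ hσ (relMom m p q)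
        have h2 : 0 ≤ relMom m p q := Real.sqrt_nonneg _
        show (0:ℝ) ≤ _
        positivity
      · exact (hRm.integrable_comp_of_integrable hDi).const_mul _
      · filter_upwards [hRm.quasiMeasurePreserving.ae (aux_ae_coord 1),
          hRm.quasiMeasurePreserving.ae (aux_ae_coord 2)] with q h1 h2
        exact hbnd p q (R q) (R.norm_map q) (hR q) h1 h2
    rw [integral_const_mul, hRm.integral_comp R.toHomeomorph.measurableEmbedding
      (auxDom s (β / 6)), ← hI] at hb
    unfold collFreq
    have hb2 := mul_le_mul_of_nonneg_left hb (inv_nonneg.2 hE.le)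
    refine hb2.trans ?_
    rw [Real.div_rpow hE.le hm.le]
    have e1 : energy m p ^ (1 - α / 2) = energy m p * energy m p ^ (-(α / 2)) := by
      rw [sub_eq_add_neg, Real.rpow_add hE, Real.rpow_one]
    rw [e1]
    have hmp : 0 < m ^ (-(α / 2)) := by positivity
    have e2 : (energy m p)⁻¹ * (K * (energy m p * energy m p ^ (-(α / 2))) * I) =
        K * I * energy m p ^ (-(α / 2)) := by field_simp
    have e3 : K * (I + 1) * m ^ (-(α / 2)) * (energy m p ^ (-(α / 2)) / m ^ (-(α / 2))) =
        K * (I + 1) * energy m p ^ (-(α / 2)) := by field_simp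
    rw [e2, e3]
    gcongr
    linarith
  have hpos : 0 < K * (I + 1) * m ^ (-(α / 2)) := by positivity
  refine ⟨_, hpos, main, fun p => (main p).trans ?_⟩
  have h1 : (energy m p / m) ^ (-(α / 2)) ≤ 1 := by
    apply Real.rpow_le_one_of_one_le_of_nonpos
    · rw [le_div_iff₀ hm]; linarith [aux_le_energy m hm p]
    · linarith
  exact mul_le_of_le_one_right hpos.le h1
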